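/- For an integer $h\ge 1$, an $h$-Farey fraction is a reduced fraction $a/b$ with $a\in\mathbb Z$ and $1\le b\le h$; the $h$-Farey predecessor of $a/b$ is the largest $h$-Farey fraction $a'/b'$ (in reduced form) smaller than $a/b$. For a numerical semigroup $S\subseteq\mathbb N$ (a cofinite submonoid of $(\mathbb N,+)$), let $c$ be its conductor (the least integer such that $S$ contains all integers $\ge c$) and $m$ its multiplicity (the least nonzero element of $S$). Call a nonzero element of $S$ primitive if it is not the sum of two smaller elements of $S$. Let $k$ be the number of elements of $S$ smaller than $c$, $\ell$ the number of primitive elements smaller than $c$, $r$ the number of primitive elements in $[c,c+m)$, and $q=\lceil c/m\rceil$. The Eliahou number of $S$ is $E(S)=k\ell+qr-c$. Given an integer $h\ge2$, an $h$-Farey fraction $a/b$, a finite nonempty set $\Delta\subset\mathbb N$ and integers $\tau,m$, put $$c=\Big\lfloor\frac{ahm}{b}\Big\rfloor-m-\tau,\qquad \Gamma=\Big\{\Big\lfloor\frac{c+m-1}{h}\Big\rfloor-\delta \;:\; \delta\in\Delta\Big\},$$ and let $S(h,a/b,\Delta,\tau,m)$ be the semigroup generated by $m$, the elements of $\Gamma$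 and all integers $\ge c$ (assuming that $m$, $c$ and the elements of $\Gamma$ are positive). **Statement.** Let $h\ge2$ be an integer and let $a/b>1$ be an $h$-Farey fraction with $h$-Farey predecessor $a'/b'$, such that $b$ divides $h$, $b\ne1$ and $b'\ne1$. Put $\Delta=\{0,1\}$, $\delta_1=\max\Delta=1$, $$\hat\tau=\Big\lfloor\frac{(h-b)(h\delta_1+1)}{b}\Big\rfloor,\qquad \hat m=\big((b+b')h-bb'\big)\delta_1+b+b'.$$ Then for every integer $n\ge0$ the numerical semigroup $S(h,a/b,\{0,1\},\hat\tau,\hat m+bn)$ has negative Eliahou number, $E<0$. -/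

import Mathlib

/-- `a/b` is an `h`-Farey fraction: a reduced fraction with `1 ≤ b ≤ h`. -/
def IsFareyFrac (h : ℕ) (a b : ℤ) : Prop :=
  0 < b ∧ b ≤ (h : ℤ) ∧ IsCoprime a b

/-- `a'/b'` is the `h`-Farey predecessor of `a/b`: both are `h`-Farey
fractions, `a'/b' < a/b`, and no `h`-Farey fraction lies strictly between
them (so they are consecutive `h`-Farey fractions). -/
def IsFareyPred (h : ℕ) (a b a' b' : ℤ) : Prop :=
  IsFareyFrac h a b ∧ IsFareyFrac h a' b' ∧
    (a' : ℚ) / (b' : ℚ) < (a : ℚ) / (b : ℚ) ∧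
    ∀ p q : ℤ, IsFareyFrac h p q →
      (p : ℚ) / (q : ℚ) ≤ (a' : ℚ) / (b' : ℚ) ∨ (a : ℚ) / (b : ℚ) ≤ (p : ℚ) / (q : ℚ)

namespace Eliahou

/-! ### Invariants of a numerical semigroup `S ⊆ ℕ` -/

/-- An element of `S` is primitive if it is nonzero and not the sum of two
smaller elements of `S`. -/
def IsPrimitive (S : AddSubmonoid ℕ) (x : ℕ) : Prop :=
  x ∈ S ∧ x ≠ 0 ∧ ¬ ∃ u ∈ S, ∃ v ∈ S, u < x ∧ v < x ∧ u + v = x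

/-- The conductor of `S`: the least `c` such that `S` contains all integers `≥ c`. -/
noncomputable def conductor (S : AddSubmonoid ℕ) : ℕ := sInf {c : ℕ | ∀ x, c ≤ x → x ∈ S}

/-- The multiplicity of `S`: its least nonzero element (equivalently, its least
primitive element). -/
noncomputable def multiplicity (S : AddSubmonoid ℕ) : ℕ := sInf {x : ℕ | x ∈ S ∧ x ≠ 0}

/-- `k`, the rank: the number of elements of `S` smaller than the conductor. -/
noncomputable def rank (S : AddSubmonoid ℕ) : ℕ :=
  {x : ℕ | x ∈ S ∧ x < conductor S}.ncard

/-- `ℓ`, the number of left generators: primitive elements smaller than the conductor. -/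
noncomputable def nLeftGen (S : AddSubmonoid ℕ) : ℕ :=
  {x : ℕ | IsPrimitive S x ∧ x < conductor S}.ncard

/-- `r`, the number of right generators: primitive elements in `[c, c + m)`, with
`c` the conductor and `m` the multiplicity. -/
noncomputable def nRightGen (S : AddSubmonoid ℕ) : ℕ :=
  {x : ℕ | IsPrimitive S x ∧ conductor S ≤ x ∧ x < conductor S + multiplicity S}.ncard

/-- `q = ⌈c/m⌉`, the depth. -/
noncomputable def depth (S : AddSubmonoid ℕ) : ℤ :=
  ⌈(conductor S : ℚ) / (multiplicity S : ℚ)⌉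

/-- The Eliahou number `E = kℓ + qr − c`. -/
noncomputable def eliahouNumber (S : AddSubmonoid ℕ) : ℤ :=
  (rank S : ℤ) * (nLeftGen S : ℤ) + depth S * (nRightGen S : ℤ) - (conductor S : ℤ)

/-! ### The construction `S(h, a/b, Δ, τ, m)` -/

/-- The numerical semigroup `⟨m, Γ⟩_c`, generated by `m`, the elements of `Γ` and
all integers `≥ c`; here `m`, `c` and the elements of `Γ` are meant to be positive. -/
def semigroupOf (m : ℤ) (Γ : Finset ℤ) (c : ℤ) : AddSubmonoid ℕ :=
  AddSubmonoid.closure {x : ℕ | (x : ℤ) = m ∨ (x : ℤ) ∈ Γ ∨ c ≤ (x : ℤ)}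

/-- `c = ⌊ahm/b⌋ − m − τ`. -/
def Sc (h : ℕ) (a b τ m : ℤ) : ℤ :=
  ⌊(a : ℚ) * (h : ℚ) * (m : ℚ) / (b : ℚ)⌋ - m - τ

/-- `Γ = ⌊(c + m − 1)/h⌋ − Δ` (elementwise). -/
def Sgam (h : ℕ) (a b : ℤ) (Δ : Finset ℕ) (τ m : ℤ) : Finset ℤ :=
  Δ.image fun δ : ℕ => ⌊((Sc h a b τ m + m - 1 : ℤ) : ℚ) / (h : ℚ)⌋ - (δ : ℤ)

/-- The semigroup `S(h, a/b, Δ, τ, m) = ⟨m, Γ⟩_c`. -/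
def S (h : ℕ) (a b : ℤ) (Δ : Finset ℕ) (τ m : ℤ) : AddSubmonoid ℕ :=
  semigroupOf m (Sgam h a b Δ τ m) (Sc h a b τ m)

/-- `δ₁ = max Δ`. -/
def delta1 (Δ : Finset ℕ) : ℕ := Δ.sup id

/-- `τ̂ = ⌊(h − b)(hδ₁ + 1)/b⌋`. -/
def tauhat (h : ℕ) (b : ℤ) (Δ : Finset ℕ) : ℤ :=
  ⌊((h : ℚ) - (b : ℚ)) * ((h : ℚ) * (delta1 Δ : ℚ) + 1) / (b : ℚ)⌋

/-- `m̂ = ((b + b')h − bb')δ₁ + b + b'`. -/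
def mhat (h : ℕ) (b b' : ℤ) (Δ : Finset ℕ) : ℤ :=
  ((b + b') * (h : ℤ) - b * b') * (delta1 Δ : ℤ) + b + b'

end Eliahou

namespace Eliahou

/-- The numerical semigroup generated by `m`, `d`, `d + 1` and all integers `≥ c`. -/
def intervalSemigroup (m d c : ℕ) : AddSubmonoid ℕ :=
  AddSubmonoid.closure {x : ℕ | x = m ∨ x = d ∨ x = d + 1 ∨ c ≤ x}

theorem combination_mem (m d c i j e : ℕ) (he : e ≤ j) :
    i * m + j * d + e ∈ intervalSemigroup m d c := by
  have hm : m ∈ intervalSemigroup m d c := AddSubmonoid.subset_closure (by simp)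
  have hd : d ∈ intervalSemigroup m d c := AddSubmonoid.subset_closure (by simp)
  have hd' : d + 1 ∈ intervalSemigroup m d c := AddSubmonoid.subset_closure (by simp)
  obtain ⟨f, rfl⟩ := Nat.exists_eq_add_of_le he
  have := add_mem (add_mem (nsmul_mem hm i) (nsmul_mem hd' e)) (nsmul_mem hd f)
  simp only [smul_eq_mul] at this
  convert this using 1
  ring

theorem mem_of_conductor_le {m d c x : ℕ} (hx : c ≤ x) : x ∈ intervalSemigroup m d c :=
  AddSubmonoid.subset_closure (by simp [hx])

theorem exists_combination_of_mem {m d c x : ℕ} (hx : x ∈ intervalSemigroup m d c) :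
    c ≤ x ∨ ∃ i j e, e ≤ j ∧ x = i * m + j * d + e := by
  induction hx using AddSubmonoid.closure_induction with
  | mem x hx =>
    rcases hx with rfl | rfl | rfl | hx
    · exact .inr ⟨1, 0, 0, by simp, by simp⟩
    · exact .inr ⟨0, 1, 0, by simp, by simp⟩
    · exact .inr ⟨0, 1, 1, by simp, by simp⟩
    · exact .inl hx
  | zero => exact .inr ⟨0, 0, 0, by simp, by simp⟩
  | add x y _ _ hx hy =>
    rcases hx with hx | ⟨i, j, e, he, rfl⟩
    · exact .inl (by omega)
    rcases hy with hy | ⟨i', j', e', he', rfl⟩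
    · exact .inl (by omega)
    exact .inr ⟨i + i', j + j', e + e', by omega, by ring⟩

theorem not_isPrimitive_add {S : AddSubmonoid ℕ} {u v : ℕ} (hu : u ∈ S) (hv : v ∈ S)
    (hu0 : u ≠ 0) (hv0 : v ≠ 0) : ¬ IsPrimitive S (u + v) := fun h =>
  h.2.2 ⟨u, hu, v, hv, by omega, by omega, rfl⟩

theorem isPrimitive_combination {m d c i j e : ℕ} (hm : 0 < m) (hd : 0 < d) (he : e ≤ j)
    (hp : IsPrimitive (intervalSemigroup m d c) (i * m + j * d + e)) :
    i * m + j * d + e = m ∨ i * m + j * d + e = d ∨ i * m + j * d + e = d + 1 := by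
  by_contra hne
  push Not at hne
  obtain ⟨h1, h2, h3⟩ := hne
  have h0 := hp.2.1
  rcases i with _ | i
  · rcases j with _ | j
    · have : e = 0 := by omega
      simp [this] at h0
    rcases e with _ | e
    · have hx : 0 * m + (j + 1) * d + 0 = d + (0 * m + j * d + 0) := by ring
      rw [hx] at hp h2
      refine not_isPrimitive_add ?_ (combination_mem m d c 0 j 0 (by omega)) hd.ne' ?_ hp
      · simpa using combination_mem m d c 0 1 0 (by omega)
      · omega
    · have hx : 0 * m + (j + 1) * d + (e + 1) = (d + 1) + (0 * m + j * d + e) := by ring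
      rw [hx] at hp h3
      refine not_isPrimitive_add ?_ (combination_mem m d c 0 j e (by omega)) (by omega) ?_ hp
      · simpa using combination_mem m d c 0 1 1 (by omega)
      · omega
  · have hx : (i + 1) * m + j * d + e = m + (i * m + j * d + e) := by ring
    rw [hx] at hp h1
    refine not_isPrimitive_add ?_ (combination_mem m d c i j e he) hm.ne' ?_ hp
    · simpa using combination_mem m d c 1 0 0 (by omega)
    · omega

/-- Numerical data for which the multiples of `[d, d + 1]` up to the `h`-th are spread out
modulo `m`: every integer of `[s (d + 1) - h, s d + h]` lies strictly between `F s * m` and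
`(F s + 1) * m`. -/
structure SpreadData (h m d c : ℕ) (F : ℕ → ℕ) : Prop where
  two_le : 2 ≤ h
  lt_mult : h < m
  mult_lt : m < d
  conductor_add : c + m = h * (d + 1) + 1
  lower : ∀ s, 1 ≤ s → s ≤ h → F s * m + h < s * (d + 1)
  upper : ∀ s, 1 ≤ s → s ≤ h → s * d + h < (F s + 1) * m

namespace SpreadData

variable {h m d c : ℕ} {F : ℕ → ℕ}

theorem succ_lt_conductor (D : SpreadData h m d c F) : d + 1 < c := by
  have h1 := D.conductor_add
  have h2 := D.mult_lt
  have h3 : 2 * (d + 1) ≤ h * (d + 1) := Nat.mul_le_mul_right _ D.two_le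
  omega

theorem factor_lt_of_lt_conductor (D : SpreadData h m d c F) {i j e : ℕ}
    (hx : i * m + j * d + e < c) : j < h ∧ i < F (h - j) := by
  have h1 := D.conductor_add
  have h2 := D.lt_mult
  have hj : j < h := by
    by_contra hj
    have : h * d ≤ j * d := Nat.mul_le_mul_right _ (by omega)
    have h3 : h * (d + 1) = h * d + h := by ring
    omega
  refine ⟨hj, ?_⟩
  obtain ⟨s, rfl⟩ := Nat.exists_eq_add_of_lt hj
  have h4 := D.upper (s + 1) (by omega) (by omega)
  have h5 : j + s + 1 - j = s + 1 := by omega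
  rw [h5]
  have h6 : (i + 1) * m < (F (s + 1) + 1) * m := by nlinarith
  have := Nat.lt_of_mul_lt_mul_right h6
  omega

theorem combination_inj (D : SpreadData h m d c F) {j e j' e' : ℕ} (he : e ≤ j) (hj : j ≤ h)
    (he' : e' ≤ j') (hj' : j' ≤ h) (hmod : j * d + e ≡ j' * d + e' [MOD m]) :
    j = j' ∧ e = e' := by
  have hm := D.lt_mult
  wlog hle : j' ≤ j generalizing j e j' e'
  · have := this he' hj' he hj hmod.symm (by omega)
    exact ⟨this.1.symm, this.2.symm⟩
  obtain ⟨s, rfl⟩ := Nat.exists_eq_add_of_le hle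
  rcases Nat.eq_zero_or_pos s with rfl | hs
  · refine ⟨rfl, ?_⟩
    have : e ≡ e' [MOD m] := Nat.ModEq.add_left_cancel' _ hmod
    exact Nat.ModEq.eq_of_lt_of_lt this (by omega) (by omega)
  exfalso
  have hl := D.lower s hs (by omega)
  have hu := D.upper s hs (by omega)
  have hle' : j' * d + e' ≤ (j' + s) * d + e := by nlinarith
  obtain ⟨p, hp⟩ := (Nat.modEq_iff_dvd' hle').1 hmod.symm
  have hp' : s * d + e = e' + m * p := by
    have : (j' + s) * d = j' * d + s * d := by ring
    omega
  have hlt : F s * m < p * m := by nlinarith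
  have hgt : p * m < (F s + 1) * m := by nlinarith
  have := Nat.lt_of_mul_lt_mul_right hlt
  have := Nat.lt_of_mul_lt_mul_right hgt
  omega

theorem pred_conductor_notMem (D : SpreadData h m d c F) :
    c - 1 ∉ intervalSemigroup m d c := by
  intro hmem
  have hc := D.succ_lt_conductor
  have h1 := D.conductor_add
  rcases exists_combination_of_mem hmem with hx | ⟨i, j, e, he, hx⟩
  · omega
  obtain ⟨hj, -⟩ := D.factor_lt_of_lt_conductor (i := i) (j := j) (e := e) (by omega)
  have hm : j * d + e ≡ h * d + h [MOD m] := by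
    refine (Nat.modEq_iff_dvd' ?_).2 ⟨i + 1, ?_⟩
    · nlinarith
    · have : h * (d + 1) = h * d + h := by ring
      have : m * (i + 1) = i * m + m := by ring
      omega
  have := D.combination_inj he hj.le le_rfl le_rfl hm
  omega

theorem conductor_eq (D : SpreadData h m d c F) : conductor (intervalSemigroup m d c) = c := by
  have hmem : ∀ x, c ≤ x → x ∈ intervalSemigroup m d c := fun x hx => mem_of_conductor_le hx
  refine le_antisymm (Nat.sInf_le hmem) ?_
  by_contra hlt
  have := Nat.sInf_mem (s := {c' : ℕ | ∀ x, c' ≤ x → x ∈ intervalSemigroup m d c}) ⟨c, hmem⟩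
  refine D.pred_conductor_notMem (this (c - 1) ?_)
  change conductor _ ≤ _
  omega

theorem multiplicity_eq (D : SpreadData h m d c F) :
    multiplicity (intervalSemigroup m d c) = m := by
  have hm := D.lt_mult
  have hd := D.mult_lt
  have hc := D.succ_lt_conductor
  have hmem : m ∈ {x : ℕ | x ∈ intervalSemigroup m d c ∧ x ≠ 0} :=
    ⟨by simpa using combination_mem m d c 1 0 0 le_rfl, by omega⟩
  refine le_antisymm (Nat.sInf_le hmem) (le_csInf ⟨m, hmem⟩ ?_)
  rintro x ⟨hx, hx0⟩
  rcases exists_combination_of_mem hx with hx | ⟨i, j, e, he, rfl⟩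
  · omega
  rcases i with _ | i
  · rcases j with _ | j
    · simp at hx0; omega
    · nlinarith
  · nlinarith

theorem depth_eq (D : SpreadData h m d c F) : depth (intervalSemigroup m d c) = F h := by
  rw [depth, D.conductor_eq, D.multiplicity_eq, Int.ceil_eq_iff]
  have hm : (0 : ℚ) < m := by exact_mod_cast (Nat.zero_le h).trans_lt D.lt_mult
  have hl := D.lower h (by linarith [D.two_le]) le_rfl
  have hu := D.upper h (by linarith [D.two_le]) le_rfl
  have h1 := D.conductor_add
  rw [lt_div_iff₀ hm, div_le_iff₀ hm]
  constructor
  · have : F h * m < c + m := by omega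
    have : (F h * m : ℚ) < c + m := by exact_mod_cast this
    push_cast
    linarith
  · have : c ≤ F h * m := by nlinarith
    exact_mod_cast this

theorem nLeftGen_le (D : SpreadData h m d c F) : nLeftGen (intervalSemigroup m d c) ≤ 3 := by
  have hm := D.lt_mult
  have hd := D.mult_lt
  have hsub : {x : ℕ | IsPrimitive (intervalSemigroup m d c) x ∧
      x < conductor (intervalSemigroup m d c)} ⊆ (({m, d, d + 1} : Finset ℕ) : Set ℕ) := by
    rintro x ⟨hp, hx⟩
    rw [D.conductor_eq] at hx
    rcases exists_combination_of_mem hp.1 with hx' | ⟨i, j, e, he, rfl⟩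
    · omega
    · simpa using isPrimitive_combination (by omega) (by omega) he hp
  refine (Set.ncard_le_ncard hsub (Finset.finite_toSet _)).trans ?_
  rw [Set.ncard_coe_finset]
  exact Finset.card_le_three

theorem rank_le (D : SpreadData h m d c F) :
    rank (intervalSemigroup m d c) ≤ ∑ j ∈ Finset.range h, (j + 1) * F (h - j) := by
  classical
  let T : Finset (Σ _ : ℕ, ℕ × ℕ) := (Finset.range h).sigma
    fun j => Finset.range (j + 1) ×ˢ Finset.range (F (h - j))
  let f : (Σ _ : ℕ, ℕ × ℕ) → ℕ := fun p => p.2.2 * m + p.1 * d + p.2.1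
  have hsub : {x : ℕ | x ∈ intervalSemigroup m d c ∧
      x < conductor (intervalSemigroup m d c)} ⊆ (T.image f : Set ℕ) := by
    rintro x ⟨hp, hx⟩
    rw [D.conductor_eq] at hx
    rcases exists_combination_of_mem hp with hx' | ⟨i, j, e, he, rfl⟩
    · omega
    obtain ⟨hj, hi⟩ := D.factor_lt_of_lt_conductor hx
    rw [Finset.mem_coe, Finset.mem_image]
    refine ⟨⟨j, e, i⟩, ?_, rfl⟩
    simp only [T, Finset.mem_sigma, Finset.mem_product, Finset.mem_range]
    exact ⟨hj, by omega, hi⟩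
  refine (Set.ncard_le_ncard hsub (Finset.finite_toSet _)).trans ?_
  rw [Set.ncard_coe_finset]
  refine Finset.card_image_le.trans ?_
  simp [T, Finset.card_sigma]

theorem nRightGen_add_le (D : SpreadData h m d c F) :
    nRightGen (intervalSemigroup m d c) + ∑ j ∈ Finset.range (h + 1), (j + 1) ≤ m := by
  classical
  have hm := D.lt_mult
  have hd := D.mult_lt
  have hc := D.succ_lt_conductor
  have h1 : h * d + h + 1 = c + m := by rw [D.conductor_add]; ring
  let T : Finset (Σ _ : ℕ, ℕ) := (Finset.range (h + 1)).sigma fun j => Finset.range (j + 1)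
  have hT : ∀ p ∈ T, p.2 ≤ p.1 ∧ p.1 ≤ h ∧ p.1 * d + p.2 ≤ h * d + h := by
    intro p hp
    simp only [T, Finset.mem_sigma, Finset.mem_range] at hp
    have h2 : p.1 ≤ h := by omega
    have := Nat.mul_le_mul_right d h2
    omega
  -- the representative in `[c, c + m)` of the class of `j * d + e` modulo `m`
  let f : (Σ _ : ℕ, ℕ) → ℕ := fun p => h * d + h - (h * d + h - (p.1 * d + p.2)) % m
  have hfm : ∀ p ∈ T, ∃ i, f p = i * m + p.1 * d + p.2 := by
    intro p hp
    refine ⟨(h * d + h - (p.1 * d + p.2)) / m, ?_⟩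
    have h2 := Nat.div_add_mod' (h * d + h - (p.1 * d + p.2)) m
    have h3 := (hT p hp).2.2
    simp only [f]
    omega
  have hfr : ∀ p, c ≤ f p ∧ f p < c + m := by
    intro p
    have := Nat.mod_lt (h * d + h - (p.1 * d + p.2)) (show 0 < m by omega)
    simp only [f]
    omega
  have hinj : Set.InjOn f T := by
    rintro ⟨j, e⟩ hp ⟨j', e'⟩ hp' hff
    obtain ⟨i, hi⟩ := hfm _ hp
    obtain ⟨i', hi'⟩ := hfm _ hp'
    have hmod : j * d + e ≡ j' * d + e' [MOD m] := by
      have h2 : i * m + (j * d + e) = i' * m + (j' * d + e') := by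
        simp only at hi hi'
        omega
      have h3 := congrArg (· % m) h2
      simpa [Nat.ModEq, Nat.add_mod, Nat.mul_mod] using h3
    obtain ⟨rfl, rfl⟩ := D.combination_inj (hT _ hp).1 (hT _ hp).2.1 (hT _ hp').1
      (hT _ hp').2.1 hmod
    rfl
  have hsub : {x : ℕ | IsPrimitive (intervalSemigroup m d c) x ∧
      conductor (intervalSemigroup m d c) ≤ x ∧ x < conductor (intervalSemigroup m d c) +
        multiplicity (intervalSemigroup m d c)} ⊆
      ((Finset.Ico c (c + m) \ T.image f : Finset ℕ) : Set ℕ) := by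
    rintro x ⟨hp, hx, hx'⟩
    rw [D.conductor_eq] at hx hx'
    rw [D.multiplicity_eq] at hx'
    rw [Finset.mem_coe, Finset.mem_sdiff, Finset.mem_Ico]
    refine ⟨⟨hx, hx'⟩, fun hmem => ?_⟩
    obtain ⟨p, hpT, rfl⟩ := Finset.mem_image.1 hmem
    obtain ⟨i, hi⟩ := hfm p hpT
    rw [hi] at hp hx
    have := isPrimitive_combination (by omega) (by omega) (hT p hpT).1 hp
    omega
  have hle := Set.ncard_le_ncard hsub (Finset.finite_toSet _)
  rw [Set.ncard_coe_finset] at hle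
  have himg : T.image f ⊆ Finset.Ico c (c + m) := by
    intro x hx
    obtain ⟨p, -, rfl⟩ := Finset.mem_image.1 hx
    exact Finset.mem_Ico.2 (hfr p)
  have hcard := Finset.card_sdiff_add_card_eq_card himg
  rw [Finset.card_image_of_injOn hinj, Nat.card_Ico] at hcard
  have hTc : T.card = ∑ j ∈ Finset.range (h + 1), (j + 1) := by
    simp [T, Finset.card_sigma]
  rw [nRightGen]
  omega

theorem eliahouNumber_le (D : SpreadData h m d c F) :
    2 * eliahouNumber (intervalSemigroup m d c) ≤
      6 * ∑ j ∈ Finset.range h, ((j : ℤ) + 1) * F (h - j) +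
        F h * (2 * m - (h + 1) * (h + 2)) - 2 * c := by
  rw [eliahouNumber, D.depth_eq, D.conductor_eq]
  have hk := D.rank_le
  have hl := D.nLeftGen_le
  have hr := D.nRightGen_add_le
  have hg : (∑ j ∈ Finset.range (h + 1), (j + 1)) * 2 = (h + 1) * (h + 2) := by
    have := Finset.sum_range_succ' (fun i => i) (h + 1)
    rw [add_zero] at this
    rw [← this, Finset.sum_range_id_mul_two]
    simp only [Nat.add_sub_cancel]
    ring
  have hr2 : 2 * nRightGen (intervalSemigroup m d c) + (h + 1) * (h + 2) ≤ 2 * m := by omega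
  have hkl := Nat.mul_le_mul hk hl
  zify at hkl hr2
  have := mul_le_mul_of_nonneg_left hr2 (Int.natCast_nonneg (F h))
  linarith

end SpreadData

end Eliahou

theorem IsFareyPred.det_eq_one_and_lt_add {h : ℕ} {a b a' b' : ℤ} (hF : IsFareyPred h a b a' b') :
    a * b' - a' * b = 1 ∧ (h : ℤ) < b + b' := by
  obtain ⟨⟨hb0, hbh, hcop⟩, ⟨hb0', hbh', hcop'⟩, hlt, hbetween⟩ := hF
  obtain ⟨u, v, huv⟩ := hcop
  -- a solution of `a * y - b * x = 1` with `h - b < y ≤ h`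
  obtain ⟨x, y, hxy, hyl, hyh⟩ : ∃ x y : ℤ, a * y - b * x = 1 ∧ (h : ℤ) < b + y ∧ y ≤ h := by
    refine ⟨-v + a * ((h - u) / b), u + b * ((h - u) / b), by linarith, ?_, ?_⟩
    · linarith [Int.emod_add_mul_ediv ((h : ℤ) - u) b, Int.emod_lt_of_pos ((h : ℤ) - u) hb0]
    · linarith [Int.emod_add_mul_ediv ((h : ℤ) - u) b, Int.emod_nonneg ((h : ℤ) - u) hb0.ne']
  have hy0 : 0 < y := by linarith
  have hq : ∀ {z : ℤ}, 0 < z → (0 : ℚ) < z := fun hz => by exact_mod_cast hz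
  have hdet : 1 ≤ a * b' - a' * b := by
    rw [div_lt_div_iff₀ (hq hb0') (hq hb0)] at hlt
    have : a' * b < a * b' := by exact_mod_cast hlt
    linarith
  have hxle : x * b' ≤ a' * y := by
    rcases hbetween x y ⟨hy0, hyh, -b, a, by linarith⟩ with hle | hle
    · rw [div_le_div_iff₀ (hq hy0) (hq hb0')] at hle
      exact_mod_cast hle
    · rw [div_le_div_iff₀ (hq hb0) (hq hy0)] at hle
      have : a * y ≤ x * b := by exact_mod_cast hle
      linarith
  have hid : b' = y * (a * b' - a' * b) + b * (a' * y - x * b') := by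
    linear_combination -b' * hxy
  have heq : a' * y = x * b' := by
    by_contra hne
    have h1 : 1 ≤ a' * y - x * b' := by
      have := lt_of_le_of_ne hxle (Ne.symm hne)
      linarith
    nlinarith
  have hb'_eq : b' = y * (a * b' - a' * b) := by
    linear_combination hid + b * heq
  have ha'_eq : a' = x * (a * b' - a' * b) := by
    linear_combination -a' * hxy + a * heq
  have hunit : IsUnit (a * b' - a' * b) :=
    hcop'.isUnit_of_dvd' ⟨x, by rw [mul_comm]; exact ha'_eq⟩ ⟨y, by rw [mul_comm]; exact hb'_eq⟩
  have hone : a * b' - a' * b = 1 := by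
    rcases Int.isUnit_iff.1 hunit with h1 | h1
    · exact h1
    · omega
  refine ⟨hone, ?_⟩
  rw [hone, mul_one] at hb'_eq
  rw [hb'_eq]
  exact hyl

namespace Eliahou

/-- `ceilRem a b x` is the representative of `a * x` modulo `b` in `[1, b]`. -/
def ceilRem (a b x : ℤ) : ℤ := (a * x - 1) % b + 1

theorem ceilRem_pos {b : ℤ} (hb : 0 < b) (a x : ℤ) : 1 ≤ ceilRem a b x := by
  have := Int.emod_nonneg (a * x - 1) hb.ne'
  rw [ceilRem]; linarith

theorem ceilRem_le {b : ℤ} (hb : 0 < b) (a x : ℤ) : ceilRem a b x ≤ b := by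
  have := Int.emod_lt_of_pos (a * x - 1) hb
  rw [ceilRem]; linarith

theorem ceilRem_add_mul (a b x : ℤ) : ceilRem a b x + b * ((a * x - 1) / b) = a * x := by
  rw [ceilRem]; linarith [Int.emod_add_mul_ediv (a * x - 1) b]

theorem ceilRem_sub_mul (a b x k : ℤ) : ceilRem a b (x - b * k) = ceilRem a b x := by
  rw [ceilRem, ceilRem, show a * (x - b * k) - 1 = a * x - 1 + b * (-(a * k)) by ring,
    Int.add_mul_emod_self_left]

/-- Negated multiples of a unit modulo `b` run through all residues. -/
theorem sum_comp_ceilRem_neg {a : ℤ} {b : ℕ} (hb : 0 < b) (hab : IsCoprime a (b : ℤ))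
    (f : ℤ → ℤ) :
    ∑ v ∈ Finset.range b, f (ceilRem a b (-v)) = ∑ v ∈ Finset.range b, f (v + 1) := by
  have hb' : (0 : ℤ) < b := by exact_mod_cast hb
  let τ : ℕ → ℕ := fun v => ((a * (-v) - 1) % b).toNat
  have hτ : ∀ v, (τ v : ℤ) = (a * (-v) - 1) % b := fun v =>
    Int.toNat_of_nonneg (Int.emod_nonneg _ hb'.ne')
  have hmaps : ∀ v, τ v < b := fun v => by
    have := Int.emod_lt_of_pos (a * (-v) - 1) hb'
    rw [← hτ] at this
    exact_mod_cast this
  have hinj : Set.InjOn τ (Finset.range b) := by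
    intro v hv w hw hvw
    have h1 : (a * (-v) - 1) % b = (a * (-w) - 1) % (b : ℤ) := by rw [← hτ, ← hτ, hvw]
    have h2 : (b : ℤ) ∣ a * (w - v) := by
      have := Int.ModEq.dvd (show (a * (-w) - 1) ≡ (a * (-v) - 1) [ZMOD b] from h1.symm)
      convert this using 1
      ring
    have h3 := hab.symm.dvd_of_dvd_mul_left h2
    have h4 : v ≡ w [MOD b] := (Nat.modEq_iff_dvd).2 h3
    exact Nat.ModEq.eq_of_lt_of_lt h4 (Finset.mem_range.1 hv) (Finset.mem_range.1 hw)
  have himg : (Finset.range b).image τ = Finset.range b := by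
    refine Finset.eq_of_subset_of_card_le ?_ ?_
    · intro x hx
      obtain ⟨v, -, rfl⟩ := Finset.mem_image.1 hx
      exact Finset.mem_range.2 (hmaps v)
    · rw [Finset.card_image_of_injOn hinj]
  conv_rhs => rw [← himg, Finset.sum_image hinj]
  refine Finset.sum_congr rfl fun v _ => ?_
  rw [hτ, ceilRem]

theorem two_mul_sum_range_succ_cast (b : ℕ) :
    2 * ∑ v ∈ Finset.range b, ((v : ℤ) + 1) = b * (b + 1) := by
  induction b with
  | zero => simp
  | succ b ih => rw [Finset.sum_range_succ, mul_add, ih]; push_cast; ring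

theorem six_mul_sum_range_succ_sq (b : ℕ) :
    6 * ∑ v ∈ Finset.range b, ((v : ℤ) + 1) ^ 2 = (b * (b + 1) * (2 * b + 1) : ℤ) := by
  induction b with
  | zero => simp
  | succ b ih => rw [Finset.sum_range_succ, mul_add, ih]; push_cast; ring

theorem six_mul_sum_succ_mul (b : ℕ) (σ : ℕ → ℤ)
    (h1 : ∑ v ∈ Finset.range b, σ v = ∑ v ∈ Finset.range b, ((v : ℤ) + 1))
    (h2 : ∑ v ∈ Finset.range b, σ v ^ 2 = ∑ v ∈ Finset.range b, ((v : ℤ) + 1) ^ 2) :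
    6 * ∑ v ∈ Finset.range b, ((v : ℤ) + 1) * σ v = b * (b + 1) * (b + 2) +
      3 * ∑ v ∈ Finset.range b, ((v : ℤ) + 1 + σ v - (b + 1)) ^ 2 := by
  have hexp : ∑ v ∈ Finset.range b, ((v : ℤ) + 1 + σ v - (b + 1)) ^ 2 =
      2 * ∑ v ∈ Finset.range b, ((v : ℤ) + 1) * σ v + ∑ v ∈ Finset.range b, ((v : ℤ) + 1) ^ 2 +
      ∑ v ∈ Finset.range b, σ v ^ 2 - 2 * (b + 1) * ∑ v ∈ Finset.range b, ((v : ℤ) + 1)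
      - 2 * (b + 1) * ∑ v ∈ Finset.range b, σ v + b * (b + 1) ^ 2 := by
    have : (b : ℤ) * (b + 1) ^ 2 = ∑ v ∈ Finset.range b, ((b : ℤ) + 1) ^ 2 := by simp
    rw [this]
    simp only [Finset.mul_sum, ← Finset.sum_add_distrib, ← Finset.sum_sub_distrib]
    exact Finset.sum_congr rfl fun v _ => by ring
  have h3 := two_mul_sum_range_succ_cast b
  have h4 := six_mul_sum_range_succ_sq b
  rw [hexp, h1, h2]
  linear_combination (-h4) + 6 * (b + 1) * h3

theorem sum_range_mul_periodic (b t : ℕ) (σ : ℕ → ℤ) (hσ : ∀ u v, σ (b * u + v) = σ v) :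
    2 * ∑ j ∈ Finset.range (b * t), ((j : ℤ) + 1) * σ j =
      2 * t * ∑ v ∈ Finset.range b, ((v : ℤ) + 1) * σ v +
        b * t * (t - 1) * ∑ v ∈ Finset.range b, σ v := by
  induction t with
  | zero => simp
  | succ t ih =>
    have hblock : ∑ v ∈ Finset.range b, (((b * t + v : ℕ) : ℤ) + 1) * σ (b * t + v) =
        b * t * ∑ v ∈ Finset.range b, σ v + ∑ v ∈ Finset.range b, ((v : ℤ) + 1) * σ v := by
      rw [Finset.mul_sum, ← Finset.sum_add_distrib]
      refine Finset.sum_congr rfl fun v _ => ?_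
      rw [hσ]; push_cast; ring
    rw [mul_add, mul_one, Finset.sum_range_add, mul_add, ih, hblock]
    push_cast
    ring

/-- The weighted sum of remainders is smallest for `a ≡ 1`, where it would give equality when
`t = 1`. -/
theorem lt_six_mul_sum_ceilRem {a : ℤ} {b t : ℕ} (hb : 2 ≤ b) (ht : 1 ≤ t)
    (hab : IsCoprime a (b : ℤ)) (ha : t = 1 → ¬ (b : ℤ) ∣ a - 1) :
    (b : ℤ) * (b * t + 1) * (b * t + 2 * t) <
      6 * ∑ j ∈ Finset.range (b * t), ((j : ℤ) + 1) * ceilRem a b (-j) := by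
  have hs1 := sum_comp_ceilRem_neg (by omega) hab id
  have hs2 := sum_comp_ceilRem_neg (by omega) hab (· ^ 2)
  simp only [id] at hs1 hs2
  have hW := six_mul_sum_succ_mul b (fun v => ceilRem a b (-v)) hs1 hs2
  have hper := sum_range_mul_periodic b t (fun v => ceilRem a b (-v)) (fun u v => by
    rw [← ceilRem_sub_mul a b (-(v : ℤ)) u]
    congr 1; push_cast; ring)
  have hT := two_mul_sum_range_succ_cast b
  rw [hs1] at hper
  set W := ∑ v ∈ Finset.range b, ((v : ℤ) + 1) * ceilRem a b (-v)
  set R := ∑ j ∈ Finset.range (b * t), ((j : ℤ) + 1) * ceilRem a b (-j)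
  set Q := ∑ v ∈ Finset.range b, ((v : ℤ) + 1 + ceilRem a b (-v) - (b + 1)) ^ 2 with hQ
  have hR : 12 * R = 2 * (b * (b * t + 1) * (b * t + 2 * t)) + 6 * t * Q +
      b ^ 2 * t * (t - 1) * (b - 1) := by
    linear_combination 6 * hper + 2 * t * hW + 3 * b * t * (t - 1) * hT
  have hQ0 : 0 ≤ Q := Finset.sum_nonneg fun v _ => sq_nonneg _
  have hb2 : (2 : ℤ) ≤ b := by exact_mod_cast hb
  have ht1 : (1 : ℤ) ≤ t := by exact_mod_cast ht
  rcases ht.eq_or_lt with rfl | ht2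
  · have hQ1 : 0 < Q := by
      refine Finset.sum_pos' (fun v _ => sq_nonneg _) ⟨b - 1, Finset.mem_range.2 (by omega), ?_⟩
      have hne : ceilRem a b (-((b - 1 : ℕ) : ℤ)) ≠ 1 := by
        rw [Nat.cast_sub (by omega), show -((b : ℤ) - (1 : ℕ)) = 1 - b * 1 by push_cast; ring,
          ceilRem_sub_mul, ceilRem, mul_one]
        intro h1
        exact ha rfl (Int.dvd_of_emod_eq_zero (by linarith))
      rw [Nat.cast_sub (by omega)] at hne ⊢
      have : (b : ℤ) - (1 : ℕ) + 1 + ceilRem a b (-((b : ℤ) - (1 : ℕ))) - (b + 1) ≠ 0 := by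
        intro h1
        apply hne
        push_cast at h1 ⊢
        linarith
      positivity
    push_cast at hR ⊢
    linarith
  · have ht2' : (2 : ℤ) ≤ t := by exact_mod_cast ht2
    have h1 : 0 < (b : ℤ) ^ 2 * t * (t - 1) * (b - 1) := by
      have : (0 : ℤ) < t - 1 := by linarith
      have : (0 : ℤ) < b - 1 := by linarith
      positivity
    have h2 : 0 ≤ 6 * (t : ℤ) * Q := by positivity
    linarith

end Eliahou

namespace Eliahou

theorem S_eq_intervalSemigroup {h m d c : ℕ} {a b τ : ℤ} (hc : Sc h a b τ m = c)
    (hg : ((Sc h a b τ m + m - 1 : ℤ) : ℚ) / (h : ℚ) = (d + 1 : ℤ)) :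
    S h a b {0, 1} τ m = intervalSemigroup m d c := by
  rw [S, semigroupOf, intervalSemigroup, Sgam, hg, Int.floor_intCast, hc]
  congr 1
  ext x
  simp only [Finset.image_insert, Finset.image_singleton, Finset.mem_insert,
    Finset.mem_singleton, Set.mem_ofPred_eq]
  omega

/-- The spread condition for the family, from the Farey neighbour relations. -/
theorem spread_bounds {h a b a' b' m d s F : ℤ} (hb : 2 ≤ b) (hbh : b ≤ h) (hb' : 0 < b')
    (hdet : a * b' - a' * b = 1) (hsum : h < b + b') (hcop : IsCoprime a b)
    (hm : b * h + b' * (h - b + 1) + b ≤ m) (hd : b * d = a * m - 1 - h)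
    (hs1 : 1 ≤ s) (hsh : s ≤ h) (hF : ceilRem a b s + b * F = a * s) :
    F * m + h < s * (d + 1) ∧ s * d + h < (F + 1) * m := by
  have hb0 : 0 < b := by linarith
  have hρ1 := ceilRem_pos hb0 a s
  have hρb := ceilRem_le hb0 a s
  set ρ := ceilRem a b s
  have hprod : 0 ≤ b' * (h - b + 1) := mul_nonneg hb'.le (by linarith)
  have hbh0 : 0 < b * h := by nlinarith
  have hsρ : s ≤ ρ * b' := by
    by_contra hlt
    have hid : s = ρ * b' + b * (F * b' - s * a') := by
      linear_combination -b' * hF - s * hdet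
    have hpos : 1 ≤ F * b' - s * a' := by
      by_contra hle
      have : b * (F * b' - s * a') ≤ 0 := mul_nonpos_of_nonneg_of_nonpos hb0.le (by linarith)
      linarith
    nlinarith
  constructor
  · have h1 : s * (h - b + 1) ≤ ρ * (b' * (h - b + 1)) := by
      nlinarith
    have h2 : b * h + b ≤ ρ * (b * h + b) := by nlinarith
    have h3 : ρ * (b * h + b' * (h - b + 1) + b) ≤ ρ * m := by nlinarith
    have h4 : b * (F * m + h) < b * (s * (d + 1)) := by
      have e1 : b * (s * (d + 1)) - b * (F * m + h) = ρ * m - s * (h - b + 1) - b * h := by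
        linear_combination s * hd - m * hF
      linarith
    exact lt_of_mul_lt_mul_left h4 hb0.le
  · have e1 : b * ((F + 1) * m) - b * (s * d + h) = (b - ρ) * m + s * (h + 1) - b * h := by
      linear_combination m * hF - s * hd
    have h4 : b * (s * d + h) < b * ((F + 1) * m) := by
      rcases hρb.eq_or_lt with hρ | hρ
      · have hdvd : b ∣ s := hcop.symm.dvd_of_dvd_mul_left ⟨F + 1, by rw [← hF, hρ]; ring⟩
        have := Int.le_of_dvd (by linarith) hdvd
        rw [hρ] at e1
        nlinarith
      · have : m ≤ (b - ρ) * m := by nlinarith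
        nlinarith
    exact lt_of_mul_lt_mul_left h4 hb0.le

theorem sum_range_succ_mul_sub (h : ℕ) :
    6 * ∑ j ∈ Finset.range h, ((j : ℤ) + 1) * (h - j) = (h * (h + 1) * (h + 2) : ℤ) := by
  have h1 := two_mul_sum_range_succ_cast h
  have h2 := six_mul_sum_range_succ_sq h
  have h3 : ∑ j ∈ Finset.range h, ((j : ℤ) + 1) * (h - j) =
      (h + 1) * ∑ j ∈ Finset.range h, ((j : ℤ) + 1) - ∑ j ∈ Finset.range h, ((j : ℤ) + 1) ^ 2 := by
    rw [Finset.mul_sum, ← Finset.sum_sub_distrib]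
    exact Finset.sum_congr rfl fun j _ => by ring
  rw [h3]
  linear_combination 3 * (h + 1) * h1 - h2

theorem SpreadData.eliahouNumber_neg {a : ℤ} {b t m d c : ℕ} {F : ℕ → ℕ}
    (D : SpreadData (b * t) m d c F) (hb : 2 ≤ b) (ht : 1 ≤ t) (hab : IsCoprime a (b : ℤ))
    (ha : t = 1 → ¬ (b : ℤ) ∣ a - 1)
    (hF : ∀ s, 1 ≤ s → s ≤ b * t → ceilRem a b s + b * F s = a * s)
    (hc : (c : ℤ) = a * t * m - m - (t - 1) * (b * t + 1)) :
    eliahouNumber (intervalSemigroup m d c) < 0 := by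
  have hE := D.eliahouNumber_le
  have hR := lt_six_mul_sum_ceilRem hb ht hab ha
  have hbz : (2 : ℤ) ≤ b := by exact_mod_cast hb
  have hsum : (b : ℤ) * ∑ j ∈ Finset.range (b * t), ((j : ℤ) + 1) * F (b * t - j) =
      a * ∑ j ∈ Finset.range (b * t), ((j : ℤ) + 1) * ((b * t : ℕ) - j) -
        ∑ j ∈ Finset.range (b * t), ((j : ℤ) + 1) * ceilRem a b (-j) := by
    rw [Finset.mul_sum, Finset.mul_sum, ← Finset.sum_sub_distrib]
    refine Finset.sum_congr rfl fun j hj => ?_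
    have hj := Finset.mem_range.1 hj
    have h1 := hF (b * t - j) (by omega) (by omega)
    have h2 : ceilRem a b ((b * t - j : ℕ) : ℤ) = ceilRem a b (-j) := by
      rw [← ceilRem_sub_mul a b ((b * t - j : ℕ) : ℤ) t, Nat.cast_sub hj.le]
      congr 1; push_cast; ring
    rw [h2, Nat.cast_sub hj.le] at h1
    linear_combination ((j : ℤ) + 1) * h1
  have hquad := sum_range_succ_mul_sub (b * t)
  have hFh : (F (b * t) : ℤ) = a * t - 1 := by
    have h1 := hF (b * t) (Nat.mul_pos (by omega) ht) le_rfl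
    have h2 : ceilRem a b ((b * t : ℕ) : ℤ) = b := by
      rw [← ceilRem_sub_mul a b _ t, Nat.cast_mul, sub_self, ceilRem, mul_zero, zero_sub,
        ← Int.add_emod_right, Int.emod_eq_of_lt (by omega) (by omega)]
      ring
    rw [h2] at h1
    push_cast at h1
    have h3 : (b : ℤ) * (F (b * t)) = b * (a * t - 1) := by linear_combination h1
    exact mul_left_cancel₀ (by omega) h3
  rw [hFh, hc] at hE
  push_cast at hE hquad hsum hR
  set K := ∑ j ∈ Finset.range (b * t), ((j : ℤ) + 1) * F (b * t - j)
  set R := ∑ j ∈ Finset.range (b * t), ((j : ℤ) + 1) * ceilRem a b (-j)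
  set Z := ∑ j ∈ Finset.range (b * t), ((j : ℤ) + 1) * ((b : ℤ) * t - j)
  set E := eliahouNumber (intervalSemigroup m d c)
  by_contra hneg
  have hE0 : 0 ≤ E := not_lt.1 hneg
  have h1 : 0 ≤ b * (6 * K + (a * t - 1) * (2 * m - (b * t + 1) * (b * t + 2)) -
      2 * (a * t * m - m - (t - 1) * (b * t + 1))) := mul_nonneg (by linarith) (by linarith)
  have h2 : b * (6 * K + (a * t - 1) * (2 * m - (b * t + 1) * (b * t + 2)) -
      2 * (a * t * m - m - (t - 1) * (b * t + 1))) =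
      b * (b * t + 1) * (b * t + 2 * t) - 6 * R := by
    linear_combination 6 * hsum + a * hquad
  linarith

theorem delta1_zero_one : delta1 {0, 1} = 1 := by
  simp [delta1]

theorem tauhat_zero_one {b t : ℕ} (hb : 0 < b) :
    tauhat (b * t) b {0, 1} = (t - 1) * (b * t + 1) := by
  have hb' : (b : ℚ) ≠ 0 := by exact_mod_cast hb.ne'
  rw [tauhat, delta1_zero_one, Int.floor_eq_iff]
  push_cast
  have : ((b : ℚ) * t - b) * (b * t * 1 + 1) / b = (t - 1) * (b * t + 1) := by
    field_simp
  rw [this]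
  constructor <;> linarith

theorem Sc_mul_eq {b t : ℕ} (hb : 0 < b) (a τ m : ℤ) :
    Sc (b * t) a b τ m = a * t * m - m - τ := by
  have hb' : (b : ℚ) ≠ 0 := by exact_mod_cast hb.ne'
  have : (a : ℚ) * ((b * t : ℕ) : ℚ) * m / ((b : ℤ) : ℚ) = ((a * t * m : ℤ) : ℚ) := by
    push_cast
    field_simp
  rw [Sc, this, Int.floor_intCast]

end Eliahou

open Eliahou in
theorem family_b_dvd_h_eliahou_neg (h : ℕ) (hh : 2 ≤ h) (a b a' b' : ℤ)
    (hF : IsFareyPred h a b a' b') (hab : 1 < (a : ℚ) / (b : ℚ))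
    (hdvd : b ∣ (h : ℤ)) (hb : b ≠ 1) (hb' : b' ≠ 1) (n : ℕ) :
    Eliahou.eliahouNumber
      (Eliahou.S h a b {0, 1} (Eliahou.tauhat h b {0, 1})
        (Eliahou.mhat h b b' {0, 1} + b * (n : ℤ))) < 0 := by
  obtain ⟨hdet, hsum⟩ := hF.det_eq_one_and_lt_add
  obtain ⟨⟨hb0, hbh, hcop⟩, ⟨hb0', hbh', -⟩, -, -⟩ := hF
  have hba : b < a := by
    rw [one_lt_div (by exact_mod_cast hb0)] at hab
    exact_mod_cast hab
  have hb2 : 2 ≤ b := by omega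
  lift b to ℕ using hb0.le
  obtain ⟨t, rfl⟩ := Int.natCast_dvd_natCast.1 hdvd
  have hbN : 2 ≤ b := by exact_mod_cast hb2
  have ht : 1 ≤ t := by
    rcases Nat.eq_zero_or_pos t with rfl | ht
    · simp at hh
    · exact ht
  obtain ⟨m, hm⟩ : ∃ m : ℤ, m = mhat (b * t) b b' {0, 1} + b * (n : ℤ) := ⟨_, rfl⟩
  rw [← hm]
  rw [mhat, delta1_zero_one] at hm
  push_cast at hm hsum hbh hbh'
  set H : ℤ := b * t with hH
  have hslack : 0 ≤ b' * (H - b) := mul_nonneg hb0'.le (by linarith)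
  have hbn : 0 ≤ (b : ℤ) * n := by positivity
  have hbH : 2 * H ≤ b * H := by nlinarith
  have hmle : b * H + b' * (H - b + 1) + b ≤ m := by linarith
  have hmH : H + 1 < m := by linarith
  obtain ⟨d, hd⟩ : ∃ d : ℤ, (b : ℤ) * d = a * m - 1 - H :=
    ⟨a * H - a * b' + a + a * n + a' * (H + 1), by
      rw [hm]; linear_combination (-(H + 1)) * hdet⟩
  have hmd : m < d := by
    have h1 : m ≤ (a - b) * m := by nlinarith
    have h2 : (b : ℤ) * m < b * d := by linarith
    exact lt_of_mul_lt_mul_left h2 hb0.le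
  lift m to ℕ using by linarith
  lift d to ℕ using by linarith
  have hmd' : m < d := by exact_mod_cast hmd
  obtain ⟨c, hc⟩ : ∃ c : ℕ, c + m = b * t * (d + 1) + 1 := by
    refine ⟨b * t * (d + 1) + 1 - m, Nat.sub_add_cancel ?_⟩
    nlinarith
  have hcz : (c : ℤ) = a * t * m - m - (t - 1) * (b * t + 1) := by
    have : (c : ℤ) + m = b * t * (d + 1) + 1 := by exact_mod_cast hc
    linear_combination this + t * hd
  have hSc : Sc (b * t) a b ((t - 1) * (b * t + 1)) m = c := by
    rw [Sc_mul_eq (by omega), hcz]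
  rw [tauhat_zero_one (by omega), S_eq_intervalSemigroup hSc (d := d)]
  · let F : ℕ → ℕ := fun s => ((a * s - 1) / b).toNat
    have hFs : ∀ s : ℕ, 1 ≤ s → ceilRem a b s + b * F s = a * s := by
      intro s hs
      have hs' : (1 : ℤ) ≤ s := by exact_mod_cast hs
      have : 0 ≤ (a * s - 1) / (b : ℤ) := Int.ediv_nonneg (by nlinarith) hb0.le
      rw [Int.toNat_of_nonneg this, ceilRem_add_mul]
    have hbounds : ∀ s : ℕ, 1 ≤ s → s ≤ b * t →
        F s * m + b * t < s * (d + 1) ∧ s * d + b * t < (F s + 1) * m := by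
      intro s hs hst
      have hst' : (s : ℤ) ≤ H := by rw [hH]; exact_mod_cast hst
      have := spread_bounds hb2 hbh hb0' hdet hsum hcop hmle hd (by exact_mod_cast hs) hst'
        (hFs s hs)
      rw [hH] at this
      exact ⟨by exact_mod_cast this.1, by exact_mod_cast this.2⟩
    have D : SpreadData (b * t) m d c F :=
      { two_le := hh
        lt_mult := by
          have : H < m := by linarith
          rw [hH] at this
          exact_mod_cast this
        mult_lt := hmd'
        conductor_add := hc
        lower := fun s h1 h2 => (hbounds s h1 h2).1
        upper := fun s h1 h2 => (hbounds s h1 h2).2 }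
    refine D.eliahouNumber_neg hbN ht hcop ?_ (fun s h1 _ => hFs s h1) hcz
    rintro rfl hdvd1
    have h1 : (b : ℤ) ∣ b' - 1 := by
      have : b' - 1 = b * a' - (a - 1) * b' := by linear_combination hdet
      rw [this]
      exact dvd_sub (dvd_mul_right _ _) (hdvd1.mul_right _)
    have h2 := Int.le_of_dvd (by omega) h1
    push_cast at hH
    omega
  · have hcm : Sc (b * t) a b ((t - 1) * (b * t + 1)) m + m - 1 = ((b * t : ℕ) : ℤ) * (d + 1) := by
      rw [hSc]
      have : (c : ℤ) + m = (b * t : ℕ) * (d + 1) + 1 := by exact_mod_cast hc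
      linarith
    rw [hcm, Int.cast_mul, Int.cast_natCast, mul_div_cancel_left₀]
    exact_mod_cast (by omega : b * t ≠ 0)
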